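/- Fix ε, B > 0, integers 1 ≤ r ≤ m ≤ k with 2k² ≤ N, and nonnegative weights (a_{i,j})_{i,j ∈ [N]} satisfying condition A_k. Let 𝒰' be an unlabeled rooted even digraph on [N] with at most k vertices such that some representative G' = (V',E',ρ) of 𝒰' decomposes as the edge-multiset union of a rooted even digraph G = (V,E,ρ), with unlabeled class 𝒰, and a double cycle with 2m edges whose vertex set has exactly r common vertices with V. Then S(𝒰') ≤ 3e·k²·N^r·S(𝒰). -/

import Mathlib

/-- A multi digraph on `[N]`: a vertex set `V ⊆ [N]` together with a finite
multiset `E` of directed edges with endpoints in `V`. -/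
structure MultiDigraph (N : ℕ) where
  V : Finset (Fin N)
  E : Multiset (Fin N × Fin N)
  edge_mem : ∀ e ∈ E, e.1 ∈ V ∧ e.2 ∈ V

namespace MultiDigraph

variable {N : ℕ}

/-- Out-degree: number of edges leaving `v`, counted with multiplicity. -/
def degPlus (G : MultiDigraph N) (v : Fin N) : ℕ :=
  Multiset.card (G.E.filter fun e => e.1 = v)

/-- In-degree: number of edges entering `v`, counted with multiplicity. -/
def degMinus (G : MultiDigraph N) (v : Fin N) : ℕ :=
  Multiset.card (G.E.filter fun e => e.2 = v)

/-- A multi digraph is strongly connected if it has at least one vertex and one can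
travel between any two vertices following edges of `E`. -/
def StronglyConnected (G : MultiDigraph N) : Prop :=
  G.V.Nonempty ∧ ∀ u ∈ G.V, ∀ v ∈ G.V,
    Relation.ReflTransGen (fun a b => (a, b) ∈ G.E) u v

end MultiDigraph

/-- The multiset of adjacent pairs (edges) traversed by a path, with multiplicity.
A path of length `m` is recorded as a list of `m+1` vertices. -/
def pathEdges {N : ℕ} (P : List (Fin N)) : Multiset (Fin N × Fin N) :=
  ↑(P.zip P.tail)

/-- A (nonempty) path is closed if its first and last vertices coincide. -/
def IsClosedPath {N : ℕ} (P : List (Fin N)) : Prop :=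
  P ≠ [] ∧ P.head? = P.getLast?

/-- An even path: a closed path in which every ordered pair occurs an even number of
times among the adjacent pairs. -/
def IsEvenPath {N : ℕ} (P : List (Fin N)) : Prop :=
  IsClosedPath P ∧ ∀ e : Fin N × Fin N, Even ((pathEdges P).count e)

/-- The path `P` generates the multi digraph `G`. -/
def Generates {N : ℕ} (P : List (Fin N)) (G : MultiDigraph N) : Prop :=
  G.V = P.toFinset ∧ G.E = pathEdges P

/-- An even digraph is a multi digraph generated by an even closed path. -/
def IsEvenDigraph {N : ℕ} (G : MultiDigraph N) : Prop :=
  ∃ P : List (Fin N), IsEvenPath P ∧ Generates P G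

/-- A cycle: a closed path with no repeated vertices except that the first and
last coincide (a loop is a cycle of length 1). -/
def IsCycle {N : ℕ} (P : List (Fin N)) : Prop :=
  2 ≤ P.length ∧ P.head? = P.getLast? ∧ P.dropLast.Nodup

/-- A double cycle: the multi digraph generated by traversing a cycle twice. -/
def IsDoubleCycle {N : ℕ} (G : MultiDigraph N) : Prop :=
  ∃ C : List (Fin N), IsCycle C ∧ G.V = C.toFinset ∧ G.E = pathEdges C + pathEdges C

/-- A rooted multi digraph: a multi digraph with a distinguished edge. -/
structure RootedMultiDigraph (N : ℕ) where
  G : MultiDigraph N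
  root : Fin N × Fin N
  root_mem : root ∈ G.E

/-- Isomorphism of multi digraphs on `[N]`. -/
def MultiDigraph.Iso {N : ℕ} (G G' : MultiDigraph N) : Prop :=
  ∃ f : Fin N → Fin N, Set.InjOn f ↑G.V ∧ G.V.image f = G'.V ∧
    G.E.map (Prod.map f f) = G'.E

/-- Isomorphism of rooted multi digraphs on `[N]`. -/
def RootedMultiDigraph.Iso {N : ℕ} (G G' : RootedMultiDigraph N) : Prop :=
  ∃ f : Fin N → Fin N, Set.InjOn f ↑G.G.V ∧ G.G.V.image f = G'.G.V ∧
    G.G.E.map (Prod.map f f) = G'.G.E ∧ Prod.map f f G.root = G'.root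

/-- The weight `p(G) = ∏ a_{i,j}^{n_{i,j}}` of a multi digraph. -/
def pWeight {N : ℕ} (a : Fin N → Fin N → ℝ) (G : MultiDigraph N) : ℝ :=
  (G.E.map fun e => a e.1 e.2).prod

/-- The weight `p_r(G)` of a rooted multi digraph: the multiplicity of the root
edge is reduced by `2`. -/
def prWeight {N : ℕ} (a : Fin N → Fin N → ℝ) (G : RootedMultiDigraph N) : ℝ :=
  ((G.G.E - {G.root, G.root}).map fun e => a e.1 e.2).prod

/-- `S_h(𝒰)` for the unlabeled class of `U`. -/
noncomputable def Sh {N : ℕ} (a : Fin N → Fin N → ℝ) (U : MultiDigraph N) (h : ℕ) : ℝ :=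
  2 ^ h * ({G : MultiDigraph N | U.Iso G ∧ 2 ^ h ≤ pWeight a G}.ncard : ℝ)
    / ({G : MultiDigraph N | U.Iso G}.ncard : ℝ)

/-- `S_h(𝒰)` for the unlabeled class of a rooted digraph `U`. -/
noncomputable def ShR {N : ℕ} (a : Fin N → Fin N → ℝ) (U : RootedMultiDigraph N) (h : ℕ) : ℝ :=
  2 ^ h * ({G : RootedMultiDigraph N | U.Iso G ∧ 2 ^ h ≤ prWeight a G}.ncard : ℝ)
    / ({G : RootedMultiDigraph N | U.Iso G}.ncard : ℝ)

/-- The statistics `S(𝒰) = max(1, sup_h S_h(𝒰))` of a rooted class. -/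
noncomputable def SR {N : ℕ} (a : Fin N → Fin N → ℝ) (U : RootedMultiDigraph N) : ℝ :=
  max 1 (⨆ h : ℕ, ShR a U h)

/-- Condition `A_k` on a family of nonnegative weights. -/
def CondA (N k : ℕ) (ε B : ℝ) (a : Fin N → Fin N → ℝ) : Prop :=
  ∀ m : ℕ, 1 ≤ m → m ≤ k →
    (∀ C : MultiDigraph N, IsDoubleCycle C → Multiset.card C.E = 2 * m →
      (∑' h : ℕ, Sh a C h) ≤ (k : ℝ) ^ 2 ∧
      (∑' h : ℕ, (2 : ℝ) ^ ((h : ℝ) * ε / 2) * Sh a C h) ≤ (k : ℝ) ^ 2 * B ^ m) ∧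
    (∀ C : RootedMultiDigraph N, IsDoubleCycle C.G → Multiset.card C.G.E = 2 * m →
      (∑' h : ℕ, ShR a C h) ≤ (k : ℝ) ^ 2)

section OrbitCounting

open Finset

open scoped Classical in
/-- If left multiplication on a finite group permutes the fibres of `F`, all fibres have the same
size, so pulling a predicate back along `F` preserves its density. -/
theorem card_pullback_mul_ncard_range {Γ β : Type*} [Group Γ] [Fintype Γ] (F : Γ → β)
    (hF : ∀ g x y, F x = F y → F (g * x) = F (g * y)) (P : β → Prop) :
    #{x | P (F x)} * (Set.range F).ncard = {b | b ∈ Set.range F ∧ P b}.ncard * Fintype.card Γ := by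
  have hfib : ∀ b ∈ univ.image F, #{x | F x = b} = #{x | F x = F 1} := by
    intro b hb
    obtain ⟨y, -, rfl⟩ := mem_image.1 hb
    refine card_nbij' (y⁻¹ * ·) (y * ·) ?_ ?_ ?_ ?_
    · intro x hx
      simp only [coe_filter, mem_univ, true_and, Set.mem_ofPred_eq] at hx ⊢
      simpa using hF y⁻¹ _ _ hx
    · intro x hx
      simp only [coe_filter, mem_univ, true_and, Set.mem_ofPred_eq] at hx ⊢
      simpa using hF y _ _ hx
    · intro x _; simp
    · intro x _; simp
  have h₁ : #{x | P (F x)} = #((univ.image F).filter P) * #{x | F x = F 1} := by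
    rw [card_eq_sum_card_fiberwise (f := F) (t := (univ.image F).filter P)
      (fun x hx => by simpa using hx), ← smul_eq_mul, ← sum_const]
    refine sum_congr rfl fun b hb => ?_
    rw [← hfib b (mem_filter.1 hb).1, filter_filter]
    refine congrArg card (filter_congr fun x _ => ?_)
    exact ⟨fun h => h.2, fun h => ⟨h ▸ (mem_filter.1 hb).2, h⟩⟩
  have h₂ : Fintype.card Γ = #(univ.image F) * #{x | F x = F 1} := by
    rw [← card_univ, card_eq_sum_card_image F, ← smul_eq_mul, ← sum_const]
    exact sum_congr rfl hfib
  have h₃ : (Set.range F).ncard = #(univ.image F) := by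
    rw [← Set.ncard_coe_finset]; simp
  have h₄ : {b | b ∈ Set.range F ∧ P b}.ncard = #((univ.image F).filter P) := by
    rw [← Set.ncard_coe_finset]; simp
  rw [h₁, h₂, h₃, h₄]
  ring

/-- A function injective on a finset agrees there with a permutation. -/
theorem Set.InjOn.exists_perm_eqOn {α : Type*} [Fintype α] [DecidableEq α] {s : Finset α}
    {f : α → α} (hf : Set.InjOn f s) : ∃ σ : Equiv.Perm α, Set.EqOn σ f s := by
  obtain ⟨g, hg⟩ := Finset.exists_equiv_extend_of_card_eq
    (t := (Finset.univ : Finset α)) Finset.card_univ.symm (Finset.subset_univ _) hf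
  exact ⟨g.trans (Equiv.subtypeUnivEquiv Finset.mem_univ), hg⟩

end OrbitCounting

section Relabeling

variable {N : ℕ}

/-- The image of a multi digraph under a map of vertices. -/
def MultiDigraph.map (f : Fin N → Fin N) (U : MultiDigraph N) : MultiDigraph N where
  V := U.V.image f
  E := U.E.map (Prod.map f f)
  edge_mem e he := by
    obtain ⟨d, hd, rfl⟩ := Multiset.mem_map.1 he
    exact ⟨Finset.mem_image_of_mem f (U.edge_mem d hd).1,
      Finset.mem_image_of_mem f (U.edge_mem d hd).2⟩

/-- The image of a rooted multi digraph under a map of vertices. -/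
def RootedMultiDigraph.map (f : Fin N → Fin N) (U : RootedMultiDigraph N) :
    RootedMultiDigraph N where
  G := U.G.map f
  root := Prod.map f f U.root
  root_mem := Multiset.mem_map_of_mem _ U.root_mem

theorem MultiDigraph.map_map (f g : Fin N → Fin N) (U : MultiDigraph N) :
    (U.map f).map g = U.map (g ∘ f) := by
  simp [MultiDigraph.map, Finset.image_image, Multiset.map_map, Function.comp_def, Prod.map_map]

theorem RootedMultiDigraph.map_map (f g : Fin N → Fin N) (U : RootedMultiDigraph N) :
    (U.map f).map g = U.map (g ∘ f) := by
  simp [RootedMultiDigraph.map, MultiDigraph.map_map, Prod.map_map]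

theorem MultiDigraph.map_edges_congr {f g : Fin N → Fin N} {U : MultiDigraph N}
    (h : Set.EqOn f g U.V) : U.E.map (Prod.map f f) = U.E.map (Prod.map g g) :=
  Multiset.map_congr rfl fun e he =>
    Prod.ext (h (U.edge_mem e he).1) (h (U.edge_mem e he).2)

theorem MultiDigraph.map_congr {f g : Fin N → Fin N} {U : MultiDigraph N}
    (h : Set.EqOn f g U.V) : U.map f = U.map g := by
  simp only [MultiDigraph.map, MultiDigraph.mk.injEq]
  exact ⟨Finset.image_congr h, MultiDigraph.map_edges_congr h⟩

theorem RootedMultiDigraph.map_congr {f g : Fin N → Fin N} {U : RootedMultiDigraph N}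
    (h : Set.EqOn f g U.G.V) : U.map f = U.map g := by
  have hr := U.G.edge_mem _ U.root_mem
  have hG := MultiDigraph.map_congr h
  have hroot : Prod.map f f U.root = Prod.map g g U.root := Prod.ext (h hr.1) (h hr.2)
  simp only [RootedMultiDigraph.map, hG, hroot]

theorem MultiDigraph.range_map_perm (U : MultiDigraph N) :
    (Set.range fun σ : Equiv.Perm (Fin N) => U.map σ) = {G | U.Iso G} := by
  ext G
  constructor
  · rintro ⟨σ, rfl⟩
    exact ⟨σ, σ.injective.injOn, rfl, rfl⟩
  · rintro ⟨f, hf, hV, hE⟩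
    obtain ⟨σ, hσ⟩ := hf.exists_perm_eqOn
    refine ⟨σ, (MultiDigraph.map_congr hσ).trans ?_⟩
    cases G
    simp_all [MultiDigraph.map]

theorem RootedMultiDigraph.range_map_perm (U : RootedMultiDigraph N) :
    (Set.range fun σ : Equiv.Perm (Fin N) => U.map σ) = {G | U.Iso G} := by
  ext G
  constructor
  · rintro ⟨σ, rfl⟩
    exact ⟨σ, σ.injective.injOn, rfl, rfl, rfl⟩
  · rintro ⟨f, hf, hV, hE, hr⟩
    obtain ⟨σ, hσ⟩ := hf.exists_perm_eqOn
    refine ⟨σ, (RootedMultiDigraph.map_congr hσ).trans ?_⟩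
    rcases G with ⟨⟨V, E, hVE⟩, root, hroot⟩
    simp_all [MultiDigraph.map, RootedMultiDigraph.map]

end Relabeling

section LevelSets

open Finset

/-- `2^h` times the proportion of points at which `w` is at least `2^h`. -/
noncomputable def dyadicTail {Ω : Type*} [Fintype Ω] (w : Ω → ℝ) (h : ℕ) : ℝ :=
  2 ^ h * (#{x | 2 ^ h ≤ w x} : ℝ) / Fintype.card Ω

theorem dyadicTail_nonneg {Ω : Type*} [Fintype Ω] (w : Ω → ℝ) (h : ℕ) : 0 ≤ dyadicTail w h := by
  unfold dyadicTail; positivity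

theorem dyadicTail_le_sum {Ω : Type*} [Fintype Ω] [Nonempty Ω] {w : Ω → ℝ} (hw : ∀ x, 0 ≤ w x)
    (h : ℕ) : dyadicTail w h ≤ ∑ x, w x := by
  have hs : 0 ≤ ∑ x, w x := sum_nonneg fun x _ => hw x
  refine div_le_of_le_mul₀ (by positivity) hs ?_
  calc (2 : ℝ) ^ h * #{x | 2 ^ h ≤ w x} = ∑ x with 2 ^ h ≤ w x, (2 : ℝ) ^ h := by
        rw [sum_const, nsmul_eq_mul, mul_comm]
    _ ≤ ∑ x with 2 ^ h ≤ w x, w x := sum_le_sum fun x hx => (mem_filter.1 hx).2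
    _ ≤ ∑ x, w x := sum_le_sum_of_subset_of_nonneg (filter_subset _ _) fun x _ _ => hw x
    _ ≤ (∑ x, w x) * Fintype.card Ω :=
        le_mul_of_one_le_right hs (by exact_mod_cast Fintype.card_pos)

theorem exists_forall_lt_two_pow {Ω : Type*} [Finite Ω] (w : Ω → ℝ) :
    ∃ M : ℕ, ∀ x, w x < 2 ^ M := by
  cases nonempty_fintype Ω
  obtain ⟨M, hM⟩ := pow_unbounded_of_one_lt (∑ x, |w x|) one_lt_two
  exact ⟨M, fun x => (le_abs_self _).trans_lt
    ((single_le_sum (fun y _ => abs_nonneg (w y)) (mem_univ x)).trans_lt hM)⟩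

theorem sum_dyadicTail_le_tsum {Ω : Type*} [Fintype Ω] (w : Ω → ℝ) (M : ℕ) :
    ∑ i ∈ range M, dyadicTail w i ≤ ∑' i, dyadicTail w i := by
  refine Summable.sum_le_tsum _ (fun i _ => dyadicTail_nonneg w i) ?_
  obtain ⟨L, hL⟩ := exists_forall_lt_two_pow w
  refine summable_of_ne_finset_zero (s := range L) fun i hi => ?_
  have : #{x | 2 ^ i ≤ w x} = 0 := by
    refine card_eq_zero.2 (filter_eq_empty_iff.2 fun x _ => not_le.2 ((hL x).trans_le ?_))
    exact pow_le_pow_right₀ one_le_two (by simpa using hi)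
  simp [dyadicTail, this]

/-- Tail bound for a product `u * w`: if level sets of `u` and `w` are at worst positively
correlated by a factor `K`, then the dyadic tail of `u * w` is controlled by a bound on the dyadic
tails of `u` and by the sum of the dyadic tails of `w`. -/
theorem dyadicTail_mul_le {Ω : Type*} [Fintype Ω] [Nonempty Ω] {u w : Ω → ℝ} {K S T : ℝ}
    (hu : ∀ x, 0 ≤ u x) (hK : 0 ≤ K) (hS : 1 ≤ S) (hSu : ∀ h, dyadicTail u h ≤ S)
    (hT : ∑' i, dyadicTail w i ≤ T)
    (hcorr : ∀ s t : ℝ, (#{x | s ≤ u x ∧ t ≤ w x} : ℝ) * Fintype.card Ω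
      ≤ K * (#{x | s ≤ u x} * #{x | t ≤ w x})) (h : ℕ) :
    dyadicTail (fun x => u x * w x) h ≤ S + 2 * K * S * T := by
  set n : ℝ := (Fintype.card Ω : ℝ) with hn
  have hn0 : 0 < n := by rw [hn]; exact_mod_cast Fintype.card_pos
  obtain ⟨M, hM⟩ := exists_forall_lt_two_pow w
  have htail : ∀ i : ℕ, (#{x | (2 : ℝ) ^ h / 2 ^ i ≤ u x} : ℝ) * 2 ^ h ≤ S * n * 2 ^ i := by
    intro i
    rcases le_total i h with hi | hi
    · have h₁ := hSu (h - i)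
      rw [dyadicTail, div_le_iff₀ hn0, pow_sub₀ _ two_ne_zero hi, ← div_eq_mul_inv,
        div_mul_eq_mul_div, div_le_iff₀ (by positivity)] at h₁
      linarith
    · have h₁ : (#{x | (2 : ℝ) ^ h / 2 ^ i ≤ u x} : ℝ) ≤ n := by
        rw [hn]; exact_mod_cast card_le_univ _
      calc _ ≤ n * 2 ^ i := by gcongr; exact one_le_two
        _ ≤ S * n * 2 ^ i := by
          have : 0 ≤ n * 2 ^ i := by positivity
          nlinarith
  have hcover : (#{x | (2 : ℝ) ^ h ≤ u x * w x} : ℝ) ≤ #{x | (2 : ℝ) ^ h / 2 ^ 0 ≤ u x} +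
      ∑ i ∈ range M, (#{x | (2 : ℝ) ^ h / 2 ^ (i + 1) ≤ u x ∧ (2 : ℝ) ^ i ≤ w x} : ℝ) := by
    classical
    have hsub : ({x | (2 : ℝ) ^ h ≤ u x * w x} : Finset Ω) ⊆
        ({x | (2 : ℝ) ^ h / 2 ^ 0 ≤ u x} : Finset Ω) ∪ (range M).biUnion fun i =>
          {x | (2 : ℝ) ^ h / 2 ^ (i + 1) ≤ u x ∧ (2 : ℝ) ^ i ≤ w x} := by
      intro x hx
      have hx : (2 : ℝ) ^ h ≤ u x * w x := (mem_filter.1 hx).2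
      rcases lt_or_ge (w x) 1 with hw | hw
      · refine mem_union_left _ (mem_filter.2 ⟨mem_univ _, ?_⟩)
        rw [pow_zero, div_one]
        nlinarith [hu x]
      · obtain ⟨i, hi, hi'⟩ := exists_nat_pow_near hw one_lt_two
        refine mem_union_right _ (mem_biUnion.2 ⟨i, ?_, mem_filter.2 ⟨mem_univ _, ?_, hi⟩⟩)
        · exact mem_range.2 ((pow_lt_pow_iff_right₀ one_lt_two).1 (hi.trans_lt (hM x)))
        · rw [div_le_iff₀ (by positivity)]
          exact hx.trans (mul_le_mul_of_nonneg_left hi'.le (hu x))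
    have := (card_le_card hsub).trans ((card_union_le _ _).trans
      (Nat.add_le_add_left card_biUnion_le _))
    exact_mod_cast this
  have hterm : ∀ i : ℕ, 2 ^ h *
      (#{x | (2 : ℝ) ^ h / 2 ^ (i + 1) ≤ u x ∧ (2 : ℝ) ^ i ≤ w x} : ℝ) / n
      ≤ 2 * K * S * dyadicTail w i := by
    intro i
    have h₁ := hcorr (2 ^ h / 2 ^ (i + 1)) (2 ^ i)
    have h₂ := htail (i + 1)
    rw [dyadicTail, ← hn, ← mul_div_assoc]
    refine div_le_div_of_nonneg_right (le_of_mul_le_mul_right ?_ hn0) hn0.le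
    set b : ℝ := (#{x | (2 : ℝ) ^ i ≤ w x} : ℝ)
    set c : ℝ := (#{x | (2 : ℝ) ^ h / 2 ^ (i + 1) ≤ u x} : ℝ)
    calc _ = 2 ^ h * (_ * n) := mul_assoc _ _ _
      _ ≤ 2 ^ h * (K * (c * b)) := by gcongr
      _ = K * b * (c * 2 ^ h) := by ring
      _ ≤ K * b * (S * n * 2 ^ (i + 1)) := by gcongr
      _ = _ := by ring
  calc dyadicTail (fun x => u x * w x) h
      ≤ 2 ^ h * (#{x | (2 : ℝ) ^ h / 2 ^ 0 ≤ u x} +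
        ∑ i ∈ range M, (#{x | (2 : ℝ) ^ h / 2 ^ (i + 1) ≤ u x ∧ (2 : ℝ) ^ i ≤ w x} : ℝ)) / n := by
        unfold dyadicTail; gcongr
    _ = 2 ^ h * #{x | (2 : ℝ) ^ h / 2 ^ 0 ≤ u x} / n + ∑ i ∈ range M, 2 ^ h *
        (#{x | (2 : ℝ) ^ h / 2 ^ (i + 1) ≤ u x ∧ (2 : ℝ) ^ i ≤ w x} : ℝ) / n := by
        rw [mul_add, add_div, mul_sum, sum_div]
    _ ≤ S + ∑ i ∈ range M, 2 * K * S * dyadicTail w i := by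
        refine add_le_add ?_ (sum_le_sum fun i _ => hterm i)
        rw [div_le_iff₀ hn0]
        have := htail 0
        linarith
    _ ≤ S + 2 * K * S * T := by
        rw [← mul_sum]
        have := (sum_dyadicTail_le_tsum w M).trans hT
        gcongr

end LevelSets

section Permutations

open Finset

variable {α : Type*} [Fintype α] [DecidableEq α]

/-- The permutations with prescribed values on `V` are as many as those of its complement. -/
theorem card_perm_eqOn (V : Finset α) (τ : Equiv.Perm α) :
    #{σ : Equiv.Perm α | ∀ x ∈ V, σ x = τ x} = (Fintype.card α - #V).factorial := by
  have h : Fintype.card {σ : Equiv.Perm α // ∀ x ∈ V, σ x = τ x} =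
      Fintype.card (Equiv.Perm {x // x ∉ V}) := by
    refine Fintype.card_congr (Equiv.trans ?_ (Equiv.Perm.subtypeEquivSubtypePerm _).symm)
    refine (Equiv.mulLeft τ⁻¹).subtypeEquiv fun σ => ?_
    simp only [not_not, Equiv.coe_mulLeft, Equiv.Perm.mul_apply, Equiv.Perm.inv_eq_iff_eq]
  rw [Fintype.card_subtype] at h
  rw [h, Fintype.card_perm, Fintype.card_subtype_compl, Fintype.card_coe]

/-- A set of permutations determined by values on `V` is the union of cosets indexed by the
restrictions to `V`. -/
theorem card_filter_perm_eq (V : Finset α) (P : Equiv.Perm α → Prop) [DecidablePred P]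
    (hP : ∀ σ τ : Equiv.Perm α, (∀ x ∈ V, σ x = τ x) → P σ → P τ) :
    #{σ | P σ} = #((univ.filter P).image fun σ : Equiv.Perm α => fun x : V => σ x) *
      (Fintype.card α - #V).factorial := by
  rw [card_eq_sum_card_image (fun σ : Equiv.Perm α => fun x : V => σ x), ← smul_eq_mul,
    ← sum_const]
  refine sum_congr rfl fun g hg => ?_
  obtain ⟨τ, hτ, rfl⟩ := mem_image.1 hg
  rw [← card_perm_eqOn V τ, filter_filter]
  refine congrArg card (filter_congr fun σ _ => ?_)
  simp only [funext_iff, Subtype.forall]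
  exact ⟨fun h => h.2, fun h => ⟨hP τ σ (fun x hx => (h x hx).symm) (mem_filter.1 hτ).2, h⟩⟩

theorem Nat.pow_le_two_mul_descFactorial {n u : ℕ} (h : 2 * u ^ 2 ≤ n) :
    n ^ u ≤ 2 * n.descFactorial u := by
  rcases Nat.eq_zero_or_pos n with rfl | hn
  · have : u = 0 := by nlinarith
    simp [this]
  have hun : u ≤ n := by nlinarith
  have hn' : (0 : ℝ) < n := by exact_mod_cast hn
  have h' : 2 * (u : ℝ) ^ 2 ≤ n := by exact_mod_cast h
  have hun' : (u : ℝ) ≤ n := by exact_mod_cast hun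
  have h₁ : (n - u : ℕ) ^ u ≤ n.descFactorial u :=
    (Nat.pow_le_pow_left (by omega) u).trans (Nat.pow_sub_le_descFactorial n u)
  have h₂ : (1 : ℝ) / 2 ≤ (1 + -(u / n : ℝ)) ^ u := by
    have hle : (u / n : ℝ) ≤ 1 := (div_le_one hn').2 hun'
    refine le_trans ?_ (one_add_mul_le_pow (by linarith) u)
    have : (u : ℝ) * (u / n) ≤ 1 / 2 := by
      rw [← mul_div_assoc, div_le_iff₀ hn']
      nlinarith
    linarith
  have h₃ : ((n - u : ℕ) : ℝ) = n * (1 + -(u / n : ℝ)) := by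
    rw [Nat.cast_sub hun]
    field_simp
    ring
  have h₄ : (n : ℝ) ^ u ≤ 2 * ((n - u : ℕ) : ℝ) ^ u := by
    rw [h₃, mul_pow]
    have : (0 : ℝ) < (n : ℝ) ^ u := by positivity
    nlinarith
  have h₅ : n ^ u ≤ 2 * (n - u) ^ u := by exact_mod_cast h₄
  omega

theorem Nat.factorial_sub_mul_factorial_le {n u v w r : ℕ} (hu : 2 * u ^ 2 ≤ n) (hv : v ≤ u)
    (hw : w ≤ u) (hr : v + w = u + r) :
    (n - u).factorial * n.factorial ≤
      2 * n ^ r * ((n - v).factorial * (n - w).factorial) := by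
  have hun : u ≤ n := by nlinarith
  have h₁ : n ^ u * (n - u).factorial ≤ 2 * n.factorial := by
    rw [← Nat.factorial_mul_descFactorial hun]
    nlinarith [Nat.pow_le_two_mul_descFactorial hu, (n - u).factorial_pos]
  have h₂ : ∀ {t}, t ≤ n → n.factorial ≤ (n - t).factorial * n ^ t := fun ht => by
    rw [← Nat.factorial_mul_descFactorial ht]
    exact Nat.mul_le_mul_left _ (Nat.descFactorial_le_pow n _)
  refine Nat.le_of_mul_le_mul_right ?_ n.factorial_pos
  calc (n - u).factorial * n.factorial * n.factorial
      ≤ (n - u).factorial * ((n - v).factorial * n ^ v) * ((n - w).factorial * n ^ w) := by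
        gcongr
        · exact h₂ (hv.trans hun)
        · exact h₂ (hw.trans hun)
    _ = (n - u).factorial * ((n - v).factorial * (n - w).factorial) * n ^ (v + w) := by ring
    _ = n ^ r * ((n - v).factorial * (n - w).factorial) * (n ^ u * (n - u).factorial) := by
        rw [hr]; ring
    _ ≤ n ^ r * ((n - v).factorial * (n - w).factorial) * (2 * n.factorial) := by gcongr
    _ = _ := by ring

/-- Events determined by the values of a permutation on `V` and on `W` are nearly independent, up to
the factor `2 * n ^ #(V ∩ W)`. -/
theorem card_perm_and_le {V W : Finset α} {k : ℕ} (hk : #(V ∪ W) ≤ k)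
    (hcard : 2 * k ^ 2 ≤ Fintype.card α)
    (P Q : Equiv.Perm α → Prop) [DecidablePred P] [DecidablePred Q]
    (hP : ∀ σ τ : Equiv.Perm α, (∀ x ∈ V, σ x = τ x) → P σ → P τ)
    (hQ : ∀ σ τ : Equiv.Perm α, (∀ x ∈ W, σ x = τ x) → Q σ → Q τ) :
    (#{σ | P σ ∧ Q σ} : ℝ) * Fintype.card (Equiv.Perm α) ≤
      2 * (Fintype.card α : ℝ) ^ #(V ∩ W) * (#{σ | P σ} * #{σ | Q σ}) := by
  have hPQ := card_filter_perm_eq (V ∪ W) (fun σ => P σ ∧ Q σ) fun σ τ h hσ =>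
    ⟨hP σ τ (fun x hx => h x (mem_union_left _ hx)) hσ.1,
      hQ σ τ (fun x hx => h x (mem_union_right _ hx)) hσ.2⟩
  have himage : #((univ.filter fun σ => P σ ∧ Q σ).image
        fun σ : Equiv.Perm α => fun x : ↥(V ∪ W) => σ x) ≤
      #((univ.filter P).image fun σ : Equiv.Perm α => fun x : V => σ x) *
        #((univ.filter Q).image fun σ : Equiv.Perm α => fun x : W => σ x) := by
    rw [← card_product]
    refine card_le_card_of_injOn (fun g : ↥(V ∪ W) → α =>
      ((fun x : V => g ⟨x, mem_union_left _ x.2⟩ : V → α),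
        (fun x : W => g ⟨x, mem_union_right _ x.2⟩ : W → α))) ?_ ?_
    · intro g hg
      obtain ⟨σ, hσ, rfl⟩ := mem_image.1 hg
      have hσ := (mem_filter.1 hσ).2
      exact mem_product.2 ⟨mem_image.2 ⟨σ, by simpa using hσ.1, rfl⟩,
        mem_image.2 ⟨σ, by simpa using hσ.2, rfl⟩⟩
    · intro g _ g' _ h
      have h := Prod.mk.inj h
      funext ⟨x, hx⟩
      rcases mem_union.1 hx with hx' | hx'
      · exact congrFun h.1 ⟨x, hx'⟩
      · exact congrFun h.2 ⟨x, hx'⟩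
  have hfact := Nat.factorial_sub_mul_factorial_le (n := Fintype.card α) (u := #(V ∪ W))
    (by nlinarith) (card_le_card subset_union_left) (card_le_card subset_union_right)
    (card_union_add_card_inter V W).symm
  rw [Fintype.card_perm, hPQ, card_filter_perm_eq V P hP, card_filter_perm_eq W Q hQ]
  norm_cast
  rw [mul_assoc]
  exact (Nat.mul_le_mul himage hfact).trans_eq (by ring)

end Permutations

section Weights

open Finset

variable {N : ℕ} {a : Fin N → Fin N → ℝ}

/-- The weighted tail statistics of the range of `F` can be computed upstairs, on the group. -/
theorem ncard_pullback_div {Γ β : Type*} [Group Γ] [Fintype Γ] {F : Γ → β}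
    (hF : ∀ g x y, F x = F y → F (g * x) = F (g * y)) {I : Set β} (hI : Set.range F = I)
    (w : β → ℝ) (h : ℕ) :
    2 ^ h * ({b | b ∈ I ∧ 2 ^ h ≤ w b}.ncard : ℝ) / (I.ncard : ℝ) =
      dyadicTail (fun x => w (F x)) h := by
  subst hI
  have hcard := card_pullback_mul_ncard_range F hF fun b => 2 ^ h ≤ w b
  have hΓ : (Fintype.card Γ : ℝ) ≠ 0 := by exact_mod_cast Fintype.card_ne_zero
  have hI : ((Set.range F).ncard : ℝ) ≠ 0 := by
    exact_mod_cast (Set.ncard_pos (Set.finite_range F)).2 (Set.range_nonempty F) |>.ne'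
  rw [dyadicTail, div_eq_div_iff hI hΓ, mul_assoc, mul_assoc]
  congr 1
  have h' : (_ : ℝ) = _ := congrArg Nat.cast hcard.symm
  push_cast at h'
  convert h'

theorem Sh_eq_dyadicTail (U : MultiDigraph N) (h : ℕ) :
    Sh a U h = dyadicTail (fun σ : Equiv.Perm (Fin N) => pWeight a (U.map σ)) h :=
  ncard_pullback_div (fun g x y hxy => by
    simp only [Equiv.Perm.coe_mul, ← MultiDigraph.map_map, hxy]) U.range_map_perm _ h

theorem ShR_eq_dyadicTail (U : RootedMultiDigraph N) (h : ℕ) :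
    ShR a U h = dyadicTail (fun σ : Equiv.Perm (Fin N) => prWeight a (U.map σ)) h :=
  ncard_pullback_div (fun g x y hxy => by
    simp only [Equiv.Perm.coe_mul, ← RootedMultiDigraph.map_map, hxy]) U.range_map_perm _ h

theorem prWeight_nonneg (ha : ∀ i j, 0 ≤ a i j) (U : RootedMultiDigraph N) :
    0 ≤ prWeight a U :=
  Multiset.prod_nonneg fun x hx => by
    obtain ⟨e, -, rfl⟩ := Multiset.mem_map.1 hx
    exact ha _ _

theorem dyadicTail_le_SR (ha : ∀ i j, 0 ≤ a i j) (U : RootedMultiDigraph N) (h : ℕ) :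
    dyadicTail (fun σ : Equiv.Perm (Fin N) => prWeight a (U.map σ)) h ≤ SR a U := by
  rw [← ShR_eq_dyadicTail]
  refine (le_ciSup (f := fun h => ShR a U h)
    ⟨∑ σ : Equiv.Perm (Fin N), prWeight a (U.map σ), ?_⟩ h).trans (le_max_right _ _)
  rintro _ ⟨h, rfl⟩
  exact (ShR_eq_dyadicTail U h).trans_le
    (dyadicTail_le_sum (fun σ : Equiv.Perm (Fin N) => prWeight_nonneg ha (U.map σ)) h)

/-- In a rooted even digraph the root edge has multiplicity at least two. -/
theorem IsEvenDigraph.pair_root_le {U : RootedMultiDigraph N} (hU : IsEvenDigraph U.G) :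
    {U.root, U.root} ≤ U.G.E := by
  obtain ⟨P, ⟨-, heven⟩, -, hE⟩ := hU
  have h₁ := Multiset.count_pos.2 U.root_mem
  obtain ⟨c, hc⟩ := hE ▸ heven U.root
  exact (Multiset.le_count_iff_replicate_le (n := 2)).1 (by omega)

/-- Adjoining `C` to a rooted digraph multiplies the weight of every relabeling by that of `C`. -/
theorem prWeight_map_union {G' G : RootedMultiDigraph N} {C : MultiDigraph N}
    (hG : {G.root, G.root} ≤ G.G.E) (hroot : G'.root = G.root) (hE : G'.G.E = G.G.E + C.E)
    (f : Fin N → Fin N) :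
    prWeight a (G'.map f) = prWeight a (G.map f) * pWeight a (C.map f) := by
  have hle : ({Prod.map f f G.root, Prod.map f f G.root} : Multiset _) ≤
      G.G.E.map (Prod.map f f) := by
    simpa using Multiset.map_le_map (f := Prod.map f f) hG
  simp only [prWeight, pWeight, RootedMultiDigraph.map, MultiDigraph.map, hroot, hE,
    Multiset.map_add]
  rw [← tsub_add_eq_add_tsub hle, Multiset.map_add, Multiset.prod_add]

end Weights

/-- **Induction lemma, part 1.** Suppose `1 ≤ r ≤ m ≤ k`, `2k² ≤ N`, and the
nonnegative weights `a` satisfy condition `A_k`. If a rooted even digraph `G'`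
(representing the unlabeled class `𝒰'`), with at most `k` vertices, decomposes as the
edge-multiset union of a rooted even digraph `G` (representing the class `𝒰`) and a
double cycle `C` with `2m` edges sharing exactly `r` vertices with `G`, then
`S(𝒰') ≤ 3e·k²·N^r·S(𝒰)`. -/
theorem induction_lemma_one {N : ℕ} (ε B : ℝ) (hε : 0 < ε) (hB : 0 < B)
    (k m r : ℕ) (hr : 1 ≤ r) (hrm : r ≤ m) (hmk : m ≤ k) (hkN : 2 * k ^ 2 ≤ N)
    (a : Fin N → Fin N → ℝ) (ha : ∀ i j, 0 ≤ a i j)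
    (hA : CondA N k ε B a)
    (G' G : RootedMultiDigraph N) (C : MultiDigraph N)
    (hG'even : IsEvenDigraph G'.G) (hG'card : G'.G.V.card ≤ k)
    (hGeven : IsEvenDigraph G.G)
    (hC : IsDoubleCycle C) (hCE : Multiset.card C.E = 2 * m)
    (hroot : G'.root = G.root)
    (hV : G'.G.V = G.G.V ∪ C.V)
    (hE : G'.G.E = G.G.E + C.E)
    (hcommon : (G.G.V ∩ C.V).card = r) :
    SR a G' ≤ 3 * Real.exp 1 * (k : ℝ) ^ 2 * (N : ℝ) ^ r * SR a G := by
  have hk : (1 : ℝ) ≤ k := by exact_mod_cast hr.trans (hrm.trans hmk)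
  have hN : (1 : ℝ) ≤ N := by
    have : 1 ≤ k := hr.trans (hrm.trans hmk)
    exact_mod_cast (by nlinarith : 1 ≤ N)
  have hS : 1 ≤ SR a G := le_max_left _ _
  have hk2 : (1 : ℝ) ≤ (k : ℝ) ^ 2 := one_le_pow₀ hk
  have hNr : (1 : ℝ) ≤ (N : ℝ) ^ r := one_le_pow₀ hN
  have he : (5 : ℝ) ≤ 3 * Real.exp 1 := by linarith [Real.exp_one_gt_d9]
  have hkNr : (1 : ℝ) ≤ (k : ℝ) ^ 2 * (N : ℝ) ^ r := one_le_mul_of_one_le_of_one_le hk2 hNr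
  have hbound : 5 * ((k : ℝ) ^ 2 * (N : ℝ) ^ r * SR a G) ≤
      3 * Real.exp 1 * (k : ℝ) ^ 2 * (N : ℝ) ^ r * SR a G := by
    rw [show 3 * Real.exp 1 * (k : ℝ) ^ 2 * (N : ℝ) ^ r * SR a G =
      3 * Real.exp 1 * ((k : ℝ) ^ 2 * (N : ℝ) ^ r * SR a G) by ring]
    gcongr
  have hSle : SR a G ≤ (k : ℝ) ^ 2 * (N : ℝ) ^ r * SR a G :=
    le_mul_of_one_le_left (by linarith) hkNr
  refine max_le (by linarith) (ciSup_le fun h => ?_)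
  have hT := ((hA m (hr.trans hrm) hmk).1 C hC hCE).1
  simp only [Sh_eq_dyadicTail] at hT
  rw [ShR_eq_dyadicTail]
  simp only [prWeight_map_union hGeven.pair_root_le hroot hE]
  have hmain := dyadicTail_mul_le (K := 2 * (N : ℝ) ^ r)
    (fun σ : Equiv.Perm (Fin N) => prWeight_nonneg ha (G.map σ))
    (by positivity) hS (dyadicTail_le_SR ha G) hT
    (fun s t => by
      classical
      have := card_perm_and_le (V := G.G.V) (W := C.V) (hV ▸ hG'card) (by simpa using hkN)
        (fun σ => s ≤ prWeight a (G.map σ)) (fun σ => t ≤ pWeight a (C.map σ))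
        (fun σ τ hστ hσ => by rwa [← RootedMultiDigraph.map_congr hστ])
        (fun σ τ hστ hσ => by rwa [← MultiDigraph.map_congr hστ])
      rw [hcommon, Fintype.card_fin] at this
      convert this) h
  linarith
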